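/- Let n ≥ 5 and 3 ≤ k ≤ n−2, and let M ∈ S⁺(n,k) be an NLS matrix, i.e., every k×k principal minor of M is zero and det(M) ≠ 0. Assume moreover that M is diagonally congruent to G(n,k), i.e., M = D·G(n,k)·D for some invertible diagonal matrix D. Then M spans an extreme ray of S⁺(n,k). -/

import Mathlib

open Matrix

/-- The principal submatrix of `X` with rows and columns indexed by the subset `I`. -/
def principalSub {n : ℕ} (X : Matrix (Fin n) (Fin n) ℝ) (I : Finset (Fin n)) :
    Matrix I I ℝ :=
  X.submatrix (fun i => (i : Fin n)) (fun j => (j : Fin n))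

/-- Membership in the `k`-PSD closure `S⁺(n,k)`: `X` is an `n × n` real symmetric matrix
all of whose `k × k` principal submatrices are positive semidefinite. -/
def memPSDClosure {n : ℕ} (k : ℕ) (X : Matrix (Fin n) (Fin n) ℝ) : Prop :=
  X.IsSymm ∧ ∀ I : Finset (Fin n), I.card = k → (principalSub X I).PosSemidef

/-- `X` spans an extreme ray of the `k`-PSD closure `S⁺(n,k)`:
`X` is nonzero, `X ∈ S⁺(n,k)`, and whenever `X = A + B` with `A, B ∈ S⁺(n,k)`,
both `A` and `B` are nonnegative scalar multiples of `X`. -/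
def SpansExtremeRay {n : ℕ} (k : ℕ) (X : Matrix (Fin n) (Fin n) ℝ) : Prop :=
  X ≠ 0 ∧ memPSDClosure k X ∧
    ∀ A B : Matrix (Fin n) (Fin n) ℝ, memPSDClosure k A → memPSDClosure k B →
      X = A + B →
        (∃ a : ℝ, 0 ≤ a ∧ A = a • X) ∧ (∃ b : ℝ, 0 ≤ b ∧ B = b • X)

/-- The matrix `G(n,k) = (k/(k-1)) • I - (1/(k-1)) • J`, where `I` is the identity
and `J` is the all-ones matrix. -/
noncomputable def Gmat (n k : ℕ) : Matrix (Fin n) (Fin n) ℝ :=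
  ((k : ℝ) / ((k : ℝ) - 1)) • (1 : Matrix (Fin n) (Fin n) ℝ) -
    (1 / ((k : ℝ) - 1)) • Matrix.of (fun _ _ => (1 : ℝ))

lemma principalSub_mulVec {n : ℕ} (A : Matrix (Fin n) (Fin n) ℝ) (x : Fin n → ℝ)
    (I : Finset (Fin n)) (i : I) :
    (principalSub A I *ᵥ fun j : I => x j) i = ∑ j ∈ I, A i j * x j :=
  Finset.sum_coe_sort I fun j => A i j * x j

lemma dotProduct_principalSub_mulVec {n : ℕ} (A : Matrix (Fin n) (Fin n) ℝ) (x : Fin n → ℝ)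
    (I : Finset (Fin n)) :
    star (fun i : I => x i) ⬝ᵥ (principalSub A I *ᵥ fun j : I => x j) =
      ∑ i ∈ I, x i * ∑ j ∈ I, A i j * x j := by
  simp only [dotProduct, principalSub_mulVec, star_trivial]
  exact Finset.sum_coe_sort I fun i => x i * ∑ j ∈ I, A i j * x j

lemma sum_quadForm_nonneg {n k : ℕ} {A : Matrix (Fin n) (Fin n) ℝ} (hA : memPSDClosure k A)
    (x : Fin n → ℝ) {I : Finset (Fin n)} (hI : I.card = k) :
    0 ≤ ∑ i ∈ I, x i * ∑ j ∈ I, A i j * x j := by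
  rw [← dotProduct_principalSub_mulVec]
  exact (hA.2 I hI).dotProduct_mulVec_nonneg _

/-- A vector annihilated by the quadratic form of a `k × k` principal submatrix of an element of
the closure lies in the kernel of that submatrix. -/
lemma sum_mul_eq_zero_of_quadForm {n k : ℕ} {A : Matrix (Fin n) (Fin n) ℝ}
    (hA : memPSDClosure k A) (x : Fin n → ℝ) {I : Finset (Fin n)} (hI : I.card = k)
    (h0 : ∑ i ∈ I, x i * ∑ j ∈ I, A i j * x j = 0) {i : Fin n} (hi : i ∈ I) :
    ∑ j ∈ I, A i j * x j = 0 := by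
  rw [← dotProduct_principalSub_mulVec] at h0
  have h := congrFun (((hA.2 I hI).dotProduct_mulVec_zero_iff _).1 h0) ⟨i, hi⟩
  rwa [principalSub_mulVec] at h

/-- A symmetric matrix all of whose `k × k` principal submatrices have zero row sums is a
multiple of `Gmat n k`. -/
lemma eq_smul_Gmat_of_sum_eq_zero {n k : ℕ} (hk : 2 ≤ k) (hkn : k < n)
    {W : Matrix (Fin n) (Fin n) ℝ} (hW : W.IsSymm)
    (h : ∀ I : Finset (Fin n), I.card = k → ∀ i ∈ I, ∑ j ∈ I, W i j = 0) (o : Fin n) :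
    W = W o o • Gmat n k := by
  have hrow : ∀ i j l, j ≠ i → l ≠ i → W i j = W i l := by
    intro i j l hj hl
    by_cases hjl : j = l
    · rw [hjl]
    obtain ⟨S, hS1, hS2, hS3⟩ := Finset.exists_subsuperset_card_eq
      (s := {i}) (t := Finset.univ \ {j, l}) (n := k - 1)
      (by simp [hj.symm, hl.symm]) (by simp; omega)
      (by rw [Finset.card_sdiff_of_subset (by simp), Finset.card_pair hjl]; simp; omega)
    have hiS : i ∈ S := by simpa using hS1
    have hjS : j ∉ S := fun hm => by simpa using hS2 hm
    have hlS : l ∉ S := fun hm => by simpa using hS2 hm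
    have h1 := h (insert j S) (by rw [Finset.card_insert_of_notMem hjS]; omega) i (by simp [hiS])
    have h2 := h (insert l S) (by rw [Finset.card_insert_of_notMem hlS]; omega) i (by simp [hiS])
    rw [Finset.sum_insert hjS] at h1
    rw [Finset.sum_insert hlS] at h2
    linarith
  have hdiag : ∀ i j, j ≠ i → W i i = -((k : ℝ) - 1) * W i j := by
    intro i j hj
    obtain ⟨I, hI1, -, hI3⟩ := Finset.exists_subsuperset_card_eq
      (s := {i}) (t := Finset.univ) (n := k) (by simp) (by simp; omega) (by simp; omega)
    have hi : i ∈ I := by simpa using hI1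
    have h1 := h I hI3 i hi
    rw [← Finset.add_sum_erase _ _ hi, Finset.sum_congr rfl
      (fun l hl => hrow i l j (Finset.ne_of_mem_erase hl) hj), Finset.sum_const,
      Finset.card_erase_of_mem hi, hI3, nsmul_eq_mul, Nat.cast_sub (by omega)] at h1
    push_cast at h1
    linarith
  have hdd : ∀ i, W i i = W o o := by
    intro i
    by_cases hio : i = o
    · rw [hio]
    rw [hdiag i o (Ne.symm hio), hdiag o i hio, hW.apply]
  have hk0 : (k : ℝ) - 1 ≠ 0 := by
    have : (2 : ℝ) ≤ k := by exact_mod_cast hk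
    linarith
  ext i j
  by_cases hij : i = j
  · subst hij
    rw [hdd i]
    simp only [Gmat, Matrix.smul_apply, Matrix.sub_apply, one_apply_eq, of_apply, smul_eq_mul]
    field_simp
  · rw [← hdd i, hdiag i j (Ne.symm hij)]
    simp only [Gmat, Matrix.smul_apply, Matrix.sub_apply, one_apply_ne hij, of_apply, smul_eq_mul]
    field_simp
    ring

lemma sum_Gmat_eq_zero {n k : ℕ} {I : Finset (Fin n)} (hI : I.card = k) {i : Fin n}
    (hi : i ∈ I) : ∑ j ∈ I, Gmat n k i j = 0 := by
  simp [Gmat, Finset.sum_sub_distrib, one_apply, hi, hI, div_eq_mul_inv]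

/-- A summand of a matrix diagonally congruent to `Gmat n k`, in a decomposition within the
closure, is a nonnegative multiple of that matrix. -/
lemma exists_eq_smul_of_add_eq {n k : ℕ} (hk : 2 ≤ k) (hkn : k < n)
    {d : Fin n → ℝ} (hd : ∀ i, d i ≠ 0) {A B : Matrix (Fin n) (Fin n) ℝ}
    (hA : memPSDClosure k A) (hB : memPSDClosure k B)
    (hAB : diagonal d * Gmat n k * diagonal d = A + B) :
    ∃ a : ℝ, 0 ≤ a ∧ A = a • (diagonal d * Gmat n k * diagonal d) := by
  have hent : ∀ i j, A i j + B i j = d i * Gmat n k i j * d j := fun i j => by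
    rw [← Matrix.add_apply, ← hAB, mul_diagonal, diagonal_mul]
  set x : Fin n → ℝ := fun i => (d i)⁻¹ with hx
  have hker : ∀ I : Finset (Fin n), I.card = k → ∀ i ∈ I, ∑ j ∈ I, A i j * x j = 0 := by
    intro I hI i hi
    refine sum_mul_eq_zero_of_quadForm hA x hI ?_ hi
    have hsum : ∑ i ∈ I, x i * ∑ j ∈ I, A i j * x j + ∑ i ∈ I, x i * ∑ j ∈ I, B i j * x j = 0 := by
      rw [← Finset.sum_add_distrib]
      refine Finset.sum_eq_zero fun i hi => ?_
      rw [← mul_add, ← Finset.sum_add_distrib]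
      have : ∀ j ∈ I, A i j * x j + B i j * x j = d i * Gmat n k i j := fun j _ => by
        rw [← add_mul, hent, mul_assoc, mul_inv_cancel₀ (hd j), mul_one]
      rw [Finset.sum_congr rfl this, ← Finset.mul_sum, sum_Gmat_eq_zero hI hi]
      simp
    have h1 := sum_quadForm_nonneg hA x hI
    have h2 := sum_quadForm_nonneg hB x hI
    linarith
  have hW := eq_smul_Gmat_of_sum_eq_zero hk hkn (W := of fun i j => x i * (A i j * x j))
    (IsSymm.ext fun i j => by simp only [of_apply]; rw [hA.1.apply]; ring)
    (fun I hI i hi => by simp only [of_apply]; rw [← Finset.mul_sum, hker I hI i hi, mul_zero])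
    ⟨0, by omega⟩
  set o : Fin n := ⟨0, by omega⟩
  refine ⟨x o * (A o o * x o), ?_, ?_⟩
  · obtain ⟨I, hI1, -, hI3⟩ := Finset.exists_subsuperset_card_eq
      (s := {o}) (t := Finset.univ) (n := k) (by simp) (by simp; omega) (by simp; omega)
    have h := (hA.2 I hI3).diag_nonneg (i := ⟨o, by simpa using hI1⟩)
    have h' : 0 ≤ A o o := h
    nlinarith [mul_nonneg h' (mul_self_nonneg (x o))]
  · ext i j
    have h := congrFun (congrFun hW i) j
    simp only [of_apply, Matrix.smul_apply, smul_eq_mul] at h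
    rw [Matrix.smul_apply, mul_diagonal, diagonal_mul, smul_eq_mul]
    have hi := hd i
    have hj := hd j
    calc A i j = d i * (x i * (A i j * x j)) * d j := by simp only [hx]; field_simp
      _ = _ := by rw [h]; ring

/-- For `n ≥ 5` and `3 ≤ k ≤ n-2`, an NLS matrix `M ∈ S⁺(n,k)` (all `k × k`
principal minors are zero and `det M ≠ 0`) which is diagonally congruent to `G(n,k)`
spans an extreme ray of `S⁺(n,k)`. -/
theorem stmt4 {n k : ℕ} (hn : 5 ≤ n) (hk3 : 3 ≤ k) (hkn : k ≤ n - 2)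
    (M : Matrix (Fin n) (Fin n) ℝ) (hM : memPSDClosure k M)
    (hminors : ∀ I : Finset (Fin n), I.card = k → (principalSub M I).det = 0)
    (hdet : M.det ≠ 0)
    (D : Matrix (Fin n) (Fin n) ℝ) (hD : D.IsDiag) (hDunit : IsUnit D.det)
    (hcong : M = D * Gmat n k * D) :
    SpansExtremeRay k M := by
  obtain ⟨d, rfl⟩ : ∃ d, D = diagonal d := ⟨D.diag, hD.diagonal_diag.symm⟩
  have hd : ∀ i, d i ≠ 0 := by
    have h := hDunit.ne_zero
    rw [det_diagonal, Finset.prod_ne_zero_iff] at h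
    exact fun i => h i (Finset.mem_univ i)
  refine ⟨?_, hM, fun A B hA hB hAB => ?_⟩
  · rintro rfl
    have : Nonempty (Fin n) := ⟨⟨0, by omega⟩⟩
    exact hdet det_zero
  · subst hcong
    exact ⟨exists_eq_smul_of_add_eq (by omega) (by omega) hd hA hB hAB,
      exists_eq_smul_of_add_eq (by omega) (by omega) hd hB hA (hAB.trans (add_comm A B))⟩
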